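/- Let U be a normal ultrafilter on a measurable cardinal δ and let λ be a limit ordinal. If the cofinality of λ is at most δ, or the cofinality of λ is a weakly compact cardinal, then no unbounded subset of λ is fresh over Ult(V,U). -/

import Mathlib

noncomputable section

open Cardinal Set

namespace MU

/-- The type of ordinals below the initial ordinal of `δ`, serving as the underlying
set of the cardinal `δ` and indexing the ultrapower. -/
abbrev Idx (δ : Cardinal.{0}) : Type 1 := {o : Ordinal.{0} // o < δ.ord}

/-- A filter `F` is `κ`-complete (equivalently, `<κ`-closed): it is closed under
intersections of fewer than `κ` of its members. -/
def IsCComplete (κ : Cardinal.{0}) {X : Type*} (F : Filter X) : Prop :=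
  ∀ (ι : Type) (t : ι → Set X), #ι < κ → (∀ j, t j ∈ F) → (⋂ j, t j) ∈ F

/-- `U` is a normal ultrafilter on the measurable cardinal `δ`: `δ` is uncountable and
`U` is a `δ`-complete nonprincipal ultrafilter on `δ` such that every function that is
regressive on a set in `U` is constant on a set in `U`. -/
structure IsNormalUltrafilter (δ : Cardinal.{0}) (U : Ultrafilter (Idx δ)) : Prop where
  uncountable : ℵ₀ < δ
  complete : IsCComplete δ (U : Filter (Idx δ))
  nonprincipal : ∀ i : Idx δ, ({i} : Set (Idx δ)) ∉ U
  normal : ∀ f : Idx δ → Ordinal.{0}, { i : Idx δ | f i < i.1 } ∈ U →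
    ∃ c : Ordinal.{0}, { i : Idx δ | f i = c } ∈ U

variable {δ : Cardinal.{0}} {U : Ultrafilter (Idx δ)}

/-- The Łoś ordering on representatives of ordinals of the ultrapower `Ult(V,U)`. -/
def ultLT (U : Ultrafilter (Idx δ)) (f g : Idx δ → Ordinal.{0}) : Prop :=
  { i : Idx δ | f i < g i } ∈ U

theorem ultLT_wf (hU : IsNormalUltrafilter δ U) : WellFounded (ultLT U) := by
  haveI : IsIrrefl (Idx δ → Ordinal.{0}) (ultLT U) := by
    constructor
    intro f hf
    have h : ({ i : Idx δ | f i < f i } : Set (Idx δ)) = ∅ := by ext i; simp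
    rw [ultLT, h] at hf
    exact Filter.empty_notMem (U : Filter (Idx δ)) hf
  haveI : IsTrans (Idx δ → Ordinal.{0}) (ultLT U) := by
    constructor
    intro f g h hfg hgh
    have hsub : ({ i : Idx δ | f i < g i } ∩ { i : Idx δ | g i < h i } : Set (Idx δ)) ⊆
        { i : Idx δ | f i < h i } := fun i hi => show f i < h i from lt_trans hi.1 hi.2
    exact Filter.mem_of_superset (Filter.inter_mem hfg hgh) hsub
  haveI : IsStrictOrder (Idx δ → Ordinal.{0}) (ultLT U) := ⟨⟩
  rw [RelEmbedding.wellFounded_iff_isEmpty]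
  constructor
  intro g
  have hmem : ∀ n : ℕ, { i : Idx δ | g (n + 1) i < g n i } ∈ U :=
    fun n => g.map_rel_iff.2 (Nat.lt_succ_self n)
  have hint : (⋂ n : ℕ, { i : Idx δ | g (n + 1) i < g n i }) ∈ U := by
    refine hU.complete ℕ _ ?_ hmem
    rw [Cardinal.mk_nat]
    exact hU.uncountable
  obtain ⟨i, hi⟩ := Ultrafilter.nonempty_of_mem hint
  have hdesc : ∀ n : ℕ, (fun n => g n i) (n + 1) < (fun n => g n i) n :=
    fun n => Set.mem_iInter.1 hi n
  exact (RelEmbedding.wellFounded_iff_isEmpty.1 Ordinal.lt_wf).false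
    (RelEmbedding.natGT (fun n => g n i) hdesc)

/-- The ordinal represented by `f` in the transitive collapse of the ultrapower
`Ult(V,U)`, i.e. the rank of `f` in the (well-founded) Łoś ordering. -/
def ordRank (hU : IsNormalUltrafilter δ U) (f : Idx δ → Ordinal.{0}) : Ordinal.{0} :=
  sInf { o : Ordinal.{0} | Ordinal.lift.{1} o = ((ultLT_wf hU).apply f).rank }

/-- The image of an ordinal under the ultrapower embedding `j_U : V → Ult(V,U)`. -/
def jU (hU : IsNormalUltrafilter δ U) (o : Ordinal.{0}) : Ordinal.{0} :=
  ordRank hU fun _ => o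

/-- The set of ordinals that is the transitive collapse of the element of the
ultrapower `Ult(V,U)` represented by the function `f`. -/
def ultSet (hU : IsNormalUltrafilter δ U) (f : Idx δ → Set Ordinal.{0}) :
    Set Ordinal.{0} :=
  { o : Ordinal.{0} |
    ∃ g : Idx δ → Ordinal.{0}, { i : Idx δ | g i ∈ f i } ∈ U ∧ ordRank hU g = o }

/-- A set of ordinals is (the transitive collapse of) an element of the ultrapower
`Ult(V,U)`. -/
def InUlt (hU : IsNormalUltrafilter δ U) (A : Set Ordinal.{0}) : Prop :=
  ∃ f : Idx δ → Set Ordinal.{0}, (∀ i, BddAbove (f i)) ∧ A = ultSet hU f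

/-- The least upper bound of a set of ordinals. -/
def lub (A : Set Ordinal.{0}) : Ordinal.{0} :=
  sSup ((fun o => o + 1) '' A)

/-- Hamkins: a set `A` of ordinals is fresh over `Ult(V,U)` if `A ∉ Ult(V,U)` but
`A ∩ α ∈ Ult(V,U)` for every `α < lub A`. -/
def Fresh (hU : IsNormalUltrafilter δ U) (A : Set Ordinal.{0}) : Prop :=
  ¬ InUlt hU A ∧ ∀ α < lub A, InUlt hU (A ∩ Iio α)

/-- `A` is an unbounded subset of the ordinal `l`. -/
def UnbSub (A : Set Ordinal.{0}) (l : Ordinal.{0}) : Prop :=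
  A ⊆ Iio l ∧ ∀ b < l, ∃ a ∈ A, b ≤ a

/-- `A` is a closed subset of the ordinal `l`: it contains the suprema of all of its
nonempty subsets that are bounded below `l`. -/
def ClosedIn (A : Set Ordinal.{0}) (l : Ordinal.{0}) : Prop :=
  ∀ S ⊆ A, S.Nonempty → sSup S < l → sSup S ∈ A

/-- The set of limit points of a set of ordinals. -/
def limitPts (A : Set Ordinal.{0}) : Set Ordinal.{0} :=
  { b : Ordinal.{0} | (A ∩ Iio b).Nonempty ∧ sSup (A ∩ Iio b) = b }

/-- `S` is a stationary subset of the ordinal `l`. -/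
def StationaryIn (S : Set Ordinal.{0}) (l : Ordinal.{0}) : Prop :=
  S ⊆ Iio l ∧ ∀ D : Set Ordinal.{0}, ClosedIn D l → UnbSub D l → (S ∩ D).Nonempty

/-- The order type of the set of ordinals `C` is at most `o`. -/
def otpLE (C : Set Ordinal.{0}) (o : Ordinal.{0}) : Prop :=
  ∃ g : Ordinal.{0} → Ordinal.{0}, (∀ a ∈ C, g a < o) ∧
    ∀ a ∈ C, ∀ b ∈ C, a < b → g a < g b

/-- The order type of the set of ordinals `C` is (strictly) less than `o`. -/
def otpLT (C : Set Ordinal.{0}) (o : Ordinal.{0}) : Prop :=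
  ∃ o' < o, otpLE C o'

/-- `C` is a `□(Θ)`-sequence, where `Θ` is (the initial ordinal of) an uncountable
regular cardinal. -/
structure IsSquareSeq (Θ : Ordinal.{0}) (C : Ordinal.{0} → Set Ordinal.{0}) : Prop where
  closed : ∀ γ < Θ, Order.IsSuccLimit γ → ClosedIn (C γ) γ
  unbounded : ∀ γ < Θ, Order.IsSuccLimit γ → UnbSub (C γ) γ
  coherent : ∀ γ < Θ, Order.IsSuccLimit γ → ∀ β ∈ limitPts (C γ), β < γ → C β = C γ ∩ Iio β
  nontrivial : ¬ ∃ D : Set Ordinal.{0}, ClosedIn D Θ ∧ UnbSub D Θ ∧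
    ∀ γ ∈ limitPts D, γ < Θ → D ∩ Iio γ = C γ

/-- `C` is a `□_κ`-sequence: a `□(κ⁺)`-sequence all of whose clubs have order type
at most `κ`. -/
def IsSquareKappaSeq (κ : Cardinal.{0}) (C : Ordinal.{0} → Set Ordinal.{0}) : Prop :=
  IsSquareSeq (Order.succ κ).ord C ∧
    ∀ γ < (Order.succ κ).ord, Order.IsSuccLimit γ → otpLE (C γ) κ.ord

/-- `κ` is a weakly compact cardinal: `κ` is uncountable and every coloring of the
pairs of ordinals below `κ` in fewer than `κ` colors has a homogeneous set of size `κ`. -/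
def IsWeaklyCompact (κ : Cardinal.{0}) : Prop :=
  ℵ₀ < κ ∧ ∀ (ν : Type) (c : Ordinal.{0} → Ordinal.{0} → ν), #ν < κ →
    ∃ H : Set Ordinal.{0}, H ⊆ Iio κ.ord ∧ Cardinal.lift.{1} κ ≤ #H ∧
      ∀ a ∈ H, ∀ b ∈ H, ∀ a' ∈ H, ∀ b' ∈ H, a < b → a' < b' → c a b = c a' b'

/-- `κ` is a strongly compact cardinal: every `κ`-complete filter (on any set)
extends to a `κ`-complete ultrafilter. -/
def IsStronglyCompact (κ : Cardinal.{0}) : Prop :=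
  ∀ (X : Type) (F : Filter X), IsCComplete κ F →
    ∃ G : Ultrafilter X, F ≤ (G : Filter X) ∧ IsCComplete κ (G : Filter X)

/-- `κ` is a singular cardinal. -/
def IsSingular (κ : Cardinal.{0}) : Prop :=
  ℵ₀ ≤ κ ∧ κ.ord.cof < κ

/-- The cofinality of the ordinal `l` as computed inside the ultrapower `Ult(V,U)`
(as an ordinal, i.e. the image of the ultrapower's cofinality under the transitive
collapse). -/
def cofUlt (hU : IsNormalUltrafilter δ U) (l : Ordinal.{0}) : Ordinal.{0} :=
  sInf { c : Ordinal.{0} | ∃ f : Idx δ → Ordinal.{0},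
    ordRank hU f = l ∧ ordRank hU (fun i => ((f i).cof).ord) = c }

/-- The ordinal `o` is (the transitive collapse of) a cardinal of the ultrapower
`Ult(V,U)`. -/
def CardInUlt (hU : IsNormalUltrafilter δ U) (o : Ordinal.{0}) : Prop :=
  ∃ f : Idx δ → Ordinal.{0}, ordRank hU f = o ∧
    { i : Idx δ | ((f i).card).ord = f i } ∈ U

/-- The ordinal `o` is (the transitive collapse of) a regular cardinal of the
ultrapower `Ult(V,U)`. -/
def RegularInUlt (hU : IsNormalUltrafilter δ U) (o : Ordinal.{0}) : Prop :=
  ∃ f : Idx δ → Ordinal.{0}, ordRank hU f = o ∧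
    { i : Idx δ | ((f i).card).IsRegular ∧ ((f i).card).ord = f i } ∈ U

/-- The cardinal successor of the ordinal `o` as computed inside the ultrapower
`Ult(V,U)`: the least ordinal above `o` that is a cardinal in `Ult(V,U)`. -/
def succInUlt (hU : IsNormalUltrafilter δ U) (o : Ordinal.{0}) : Ordinal.{0} :=
  sInf { c : Ordinal.{0} | o < c ∧ CardInUlt hU c }

/-- The cardinality of a set of ordinals, as an (initial) ordinal: the least ordinal
`o` such that `s` is the image of a function defined on the ordinals below `o`. -/
def setCardOrd (s : Set Ordinal.{0}) : Ordinal.{0} :=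
  sInf { o : Ordinal.{0} | ∃ g : Ordinal.{0} → Ordinal.{0}, s ⊆ g '' Iio o }

open Filter Order

/-- The rank of a representative in the Łoś ordering. -/
def ultRank (hU : IsNormalUltrafilter δ U) (f : Idx δ → Ordinal.{0}) : Ordinal.{1} :=
  ((ultLT_wf hU).apply f).rank

theorem ultLT_iff {f g : Idx δ → Ordinal.{0}} : ultLT U f g ↔ ∀ᶠ i in U, f i < g i := Iff.rfl

theorem ultRank_lt (hU : IsNormalUltrafilter δ U) {f g : Idx δ → Ordinal.{0}}
    (h : ∀ᶠ i in U, f i < g i) : ultRank hU f < ultRank hU g :=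
  Acc.rank_lt_of_rel _ (ultLT_iff.2 h)

theorem ultRank_le (hU : IsNormalUltrafilter δ U) {f g : Idx δ → Ordinal.{0}}
    (h : ∀ᶠ i in U, f i ≤ g i) : ultRank hU f ≤ ultRank hU g := by
  rw [ultRank, Acc.rank_eq]
  refine Ordinal.iSup_le fun b => succ_le_of_lt (ultRank_lt hU ?_)
  filter_upwards [ultLT_iff.1 b.2, h] with i h₁ h₂ using h₁.trans_le h₂

theorem ultRank_lt_iff (hU : IsNormalUltrafilter δ U) {f g : Idx δ → Ordinal.{0}} :
    ultRank hU f < ultRank hU g ↔ ∀ᶠ i in U, f i < g i := by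
  refine ⟨fun h => ?_, ultRank_lt hU⟩
  by_contra hn
  rw [← Ultrafilter.eventually_not] at hn
  exact h.not_ge (ultRank_le hU (hn.mono fun _ => not_lt.1))

theorem exists_lift_eq_ultRank (hU : IsNormalUltrafilter δ U) (f : Idx δ → Ordinal.{0}) :
    ∃ o : Ordinal.{0}, Ordinal.lift.{1} o = ultRank hU f := by
  induction f using (ultLT_wf hU).induction with
  | _ f ih =>
  have : Small.{0} (Idx δ) := Ordinal.small_Iio δ.ord
  suffices h : ultRank hU f ≤ Ordinal.lift.{1}
      (⨆ g : ((i : Idx δ) → Iic (f i)), succ (ordRank hU fun i => (g i).1)) by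
    exact Ordinal.mem_range_lift_of_le h
  rw [ultRank, Acc.rank_eq]
  refine Ordinal.iSup_le fun b => succ_le_of_lt ?_
  have hb : ∀ᶠ i in U, b.1 i = min (b.1 i) (f i) := by
    filter_upwards [ultLT_iff.1 b.2] with i hi using (min_eq_left hi.le).symm
  have hlt : ultLT U (fun i => min (b.1 i) (f i)) f := by
    rw [ultLT_iff]
    filter_upwards [ultLT_iff.1 b.2] with i hi using min_lt_of_left_lt hi
  refine (ultRank_le hU (hb.mono fun _ => le_of_eq)).trans_lt ?_
  have hmem : Ordinal.lift.{1} (ordRank hU fun i => min (b.1 i) (f i)) =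
      ultRank hU fun i => min (b.1 i) (f i) := csInf_mem (ih _ hlt)
  rw [← hmem, Ordinal.lift_lt, ← succ_le_iff]
  exact Ordinal.le_iSup
    (fun g : ((i : Idx δ) → Iic (f i)) => succ (ordRank hU fun i => (g i).1))
    (fun i => ⟨min (b.1 i) (f i), mem_Iic.2 (min_le_right _ _)⟩)

theorem lift_ordRank (hU : IsNormalUltrafilter δ U) (f : Idx δ → Ordinal.{0}) :
    Ordinal.lift.{1} (ordRank hU f) = ultRank hU f :=
  csInf_mem (exists_lift_eq_ultRank hU f)

theorem ordRank_lt_iff (hU : IsNormalUltrafilter δ U) {f g : Idx δ → Ordinal.{0}} :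
    ordRank hU f < ordRank hU g ↔ ∀ᶠ i in U, f i < g i := by
  rw [← Ordinal.lift_lt.{1}, lift_ordRank, lift_ordRank, ultRank_lt_iff]

theorem ordRank_eq_iff (hU : IsNormalUltrafilter δ U) {f g : Idx δ → Ordinal.{0}} :
    ordRank hU f = ordRank hU g ↔ ∀ᶠ i in U, f i = g i := by
  constructor
  · intro h
    have h₁ := Ultrafilter.eventually_not.2 fun hlt => ((ordRank_lt_iff hU).2 hlt).ne h
    have h₂ := Ultrafilter.eventually_not.2 fun hlt => ((ordRank_lt_iff hU).2 hlt).ne' h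
    filter_upwards [h₁, h₂] with i hi₁ hi₂ using le_antisymm (not_lt.1 hi₂) (not_lt.1 hi₁)
  · intro h
    refine le_antisymm (not_lt.1 fun hlt => ?_) (not_lt.1 fun hlt => ?_) <;>
    · obtain ⟨i, hi, hi'⟩ := (((ordRank_lt_iff hU).1 hlt).and h).exists
      simp [hi'] at hi

theorem le_jU (hU : IsNormalUltrafilter δ U) (o : Ordinal.{0}) : o ≤ jU hU o :=
  StrictMono.le_apply (f := jU hU)
    fun _ _ hab => (ordRank_lt_iff hU).2 (Eventually.of_forall fun _ => hab)

theorem exists_ordRank_eq (hU : IsNormalUltrafilter δ U) (o : Ordinal.{0}) :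
    ∃ f, ordRank hU f = o := by
  have h : Ordinal.lift.{1} o ≤ ((ultLT_wf hU).apply fun _ => o).rank := by
    change _ ≤ ultRank hU _
    rw [← lift_ordRank, Ordinal.lift_le]
    exact le_jU hU o
  obtain ⟨f, _, hf⟩ := Acc.mem_range_rank_of_le _ h
  exact ⟨f, Ordinal.lift_inj.{1}.1 ((lift_ordRank hU f).trans hf)⟩

theorem ordRank_mem_ultSet_iff (hU : IsNormalUltrafilter δ U) {g : Idx δ → Ordinal.{0}}
    {f : Idx δ → Set Ordinal.{0}} : ordRank hU g ∈ ultSet hU f ↔ ∀ᶠ i in U, g i ∈ f i := by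
  refine ⟨?_, fun h => ⟨g, h, rfl⟩⟩
  rintro ⟨g', hg', he⟩
  filter_upwards [hg', (ordRank_eq_iff hU).1 he] with i hi hi' using hi' ▸ hi

theorem eventuallyEq_of_ultSet_eq (hU : IsNormalUltrafilter δ U) {f f' : Idx δ → Set Ordinal.{0}}
    (h : ultSet hU f = ultSet hU f') : ∀ᶠ i in U, f i = f' i := by
  by_contra hn
  rw [← Ultrafilter.eventually_not] at hn
  have hex : ∀ i, ∃ x, f i ≠ f' i → ¬ (x ∈ f i ↔ x ∈ f' i) := fun i => by
    by_contra! hc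
    exact (hc 0).1 (Set.ext fun x => (hc x).2)
  choose g hg using hex
  have hiff : (∀ᶠ i in U, g i ∈ f i) ↔ ∀ᶠ i in U, g i ∈ f' i := by
    rw [← ordRank_mem_ultSet_iff hU, ← ordRank_mem_ultSet_iff hU, h]
  by_cases hm : ∀ᶠ i in U, g i ∈ f i
  · obtain ⟨i, h₁, h₂, h₃⟩ := (hm.and ((hiff.1 hm).and hn)).exists
    exact hg i h₃ (iff_of_true h₁ h₂)
  · have hm' := Ultrafilter.eventually_not.2 fun h => hm (hiff.2 h)
    rw [← Ultrafilter.eventually_not] at hm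
    obtain ⟨i, h₁, h₂, h₃⟩ := (hm.and (hm'.and hn)).exists
    exact hg i h₃ (iff_of_false h₁ h₂)

theorem ultSet_inter_Iio (hU : IsNormalUltrafilter δ U) (f : Idx δ → Set Ordinal.{0})
    (h : Idx δ → Ordinal.{0}) :
    ultSet hU (fun i => f i ∩ Iio (h i)) = ultSet hU f ∩ Iio (ordRank hU h) := by
  ext o
  obtain ⟨g, rfl⟩ := exists_ordRank_eq hU o
  rw [mem_inter_iff, mem_Iio, ordRank_mem_ultSet_iff, ordRank_mem_ultSet_iff, ordRank_lt_iff,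
    ← eventually_and]
  rfl

/-- A subset of `l` belongs to the ultrapower as soon as it agrees below `l` with an
element of the ultrapower that is a (possibly proper) class of ordinals there. -/
theorem inUlt_of_forall (hU : IsNormalUltrafilter δ U) {A : Set Ordinal.{0}} {l : Ordinal.{0}}
    (hA : A ⊆ Iio l) (F : Idx δ → Set Ordinal.{0})
    (hF : ∀ g, ordRank hU g < l → ((∀ᶠ i in U, g i ∈ F i) ↔ ordRank hU g ∈ A)) :
    InUlt hU A := by
  obtain ⟨h, rfl⟩ := exists_ordRank_eq hU l
  refine ⟨fun i => F i ∩ Iio (h i), fun i => bddAbove_Iio.mono inter_subset_right, ?_⟩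
  rw [ultSet_inter_Iio]
  ext o
  obtain ⟨g, rfl⟩ := exists_ordRank_eq hU o
  rw [mem_inter_iff, ordRank_mem_ultSet_iff]
  exact ⟨fun hg => ⟨(hF g (hA hg)).2 hg, hA hg⟩, fun hg => (hF g hg.2).1 hg.1⟩

theorem card_add_one_lt {κ : Cardinal.{0}} (hκ : ℵ₀ ≤ κ) {o : Ordinal.{0}} (ho : o < κ.ord) :
    (o + 1).card < κ :=
  lt_ord.1 ((isSuccLimit_ord hκ).add_one_lt ho)

theorem eventually_lt_idx (hU : IsNormalUltrafilter δ U) {o : Ordinal.{0}} (ho : o < δ.ord) :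
    ∀ᶠ i : Idx δ in U, o < i.1 := by
  have hsmall : #(Shrink.{0} (Iio (o + 1))) < δ := by
    rw [← Cardinal.lift_lt.{0, 1}]
    have := Cardinal.lift_mk_shrink''.{1, 0} (Iio (o + 1))
    rw [this, Cardinal.mk_Iio_ordinal, Cardinal.lift_lt]
    exact card_add_one_lt hU.uncountable.le ho
  have h := hU.complete (Shrink.{0} (Iio (o + 1)))
    (fun j => {i : Idx δ | i.1 ≠ ((equivShrink _).symm j).1}) hsmall fun j => by
      set a := (equivShrink (Iio (o + 1))).symm j
      have ha : a.1 < δ.ord := (lt_add_one_iff.1 a.2).trans_lt ho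
      have hc : {i : Idx δ | i.1 ≠ a.1} = ({⟨a.1, ha⟩} : Set (Idx δ))ᶜ := by
        ext i
        simp [Subtype.ext_iff]
      rw [hc]
      exact Ultrafilter.compl_mem_iff_notMem.2 (hU.nonprincipal _)
  refine Filter.mem_of_superset h fun i hi => ?_
  by_contra hn
  have hio : i.1 < o + 1 := lt_add_one_iff.2 (not_lt.1 hn)
  have := mem_iInter.1 hi (equivShrink _ ⟨i.1, hio⟩)
  simp at this

theorem exists_cofinal_map {l : Ordinal.{0}} (hl : IsSuccLimit l) :
    ∃ e : Ordinal.{0} → Ordinal.{0}, (∀ ξ, e ξ < l) ∧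
      (∀ ξ η, ξ < η → η < l.cof.ord → e ξ < e η) ∧ ∀ α < l, ∃ ξ < l.cof.ord, α < e ξ := by
  obtain ⟨s, hs⟩ := Ordinal.exists_isFundamentalSeq (o := l) rfl
  have hl0 : 0 < l := hl.bot_lt
  refine ⟨fun ξ => if h : ξ < l.cof.ord then (s ⟨ξ, h⟩).1 else 0, fun ξ => ?_, ?_, ?_⟩
  · dsimp only
    split_ifs with h
    exacts [(s ⟨ξ, h⟩).2, hl0]
  · intro ξ η hξη hη
    simp only [hη, hξη.trans hη, dif_pos]
    exact hs.strictMono (Subtype.mk_lt_mk.2 hξη)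
  · intro α hα
    obtain ⟨_, ⟨ξ, rfl⟩, hξ⟩ := hs.isCofinal_range ⟨α + 1, hl.add_one_lt hα⟩
    refine ⟨ξ.1, ξ.2, ?_⟩
    have hξ2 := ξ.2
    rw [mem_Iio] at hξ2
    simp only [hξ2, dif_pos]
    exact (lt_add_one α).trans_le hξ

theorem exists_mem_gt_of_card_le {κ : Cardinal.{0}} (hκ : ℵ₀ ≤ κ) {H : Set Ordinal.{0}}
    (hH : Cardinal.lift.{1} κ ≤ #H) {o : Ordinal.{0}} (ho : o < κ.ord) : ∃ ξ ∈ H, o < ξ := by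
  by_contra! hc
  have hsub : H ⊆ Iio (o + 1) := fun ξ hξ => lt_add_one_iff.2 (hc ξ hξ)
  have hle := hH.trans (mk_le_mk_of_subset hsub)
  rw [Cardinal.mk_Iio_ordinal, Cardinal.lift_le] at hle
  exact hle.not_gt (card_add_one_lt hκ ho)

theorem IsWeaklyCompact.two_power_lt {κ μ : Cardinal.{0}} (hκ : IsWeaklyCompact κ) (hμ : μ < κ) :
    2 ^ μ < κ := by
  by_contra! hle
  have hle' : #(Iio κ.ord) ≤ #(ULift.{1} (Set μ.out)) := by
    rw [Cardinal.mk_Iio_ordinal, card_ord, mk_uLift, Cardinal.lift_le, mk_set, mk_out]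
    exact hle
  obtain ⟨j⟩ := hle'
  have hne : Nonempty μ.out := by
    rw [← mk_ne_zero_iff, mk_out]
    rintro rfl
    rw [power_zero] at hle
    exact (one_lt_aleph0.trans hκ.1).not_ge hle
  have hdiff : ∀ a b : Ordinal.{0}, ∃ d : μ.out, ∀ (ha : a < κ.ord) (hb : b < κ.ord), a ≠ b →
      ¬ (d ∈ (j ⟨a, ha⟩).down ↔ d ∈ (j ⟨b, hb⟩).down) := by
    intro a b
    by_contra! hc
    obtain ⟨ha, hb, hab, -⟩ := hc hne.some
    refine hab (congrArg Subtype.val (a₁ := (⟨a, ha⟩ : Iio κ.ord)) (a₂ := ⟨b, hb⟩)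
      (j.injective (ULift.ext _ _ (Set.ext fun d => ?_))))
    obtain ⟨_, _, _, h⟩ := hc d
    exact h
  choose c hc using hdiff
  obtain ⟨H, hHsub, hHcard, hH⟩ := hκ.2 μ.out c (by rwa [mk_out])
  have hpos : 0 < κ.ord := (isSuccLimit_ord hκ.1.le).bot_lt
  obtain ⟨x, hx, -⟩ := exists_mem_gt_of_card_le hκ.1.le hHcard hpos
  obtain ⟨y, hy, hxy⟩ := exists_mem_gt_of_card_le hκ.1.le hHcard (hHsub hx)
  obtain ⟨z, hz, hyz⟩ := exists_mem_gt_of_card_le hκ.1.le hHcard (hHsub hy)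
  have h₁ := hc x y (hHsub hx) (hHsub hy) hxy.ne
  have h₂ := hc y z (hHsub hy) (hHsub hz) hyz.ne
  have h₃ := hc x z (hHsub hx) (hHsub hz) (hxy.trans hyz).ne
  rw [hH y hy z hz x hx y hy hyz hxy] at h₂
  rw [hH x hx z hz x hx y hy (hxy.trans hyz) hxy] at h₃
  tauto

theorem le_lub {A : Set Ordinal.{0}} {l : Ordinal.{0}} (hA : UnbSub A l) : l ≤ lub A := by
  refine le_of_forall_lt fun b hb => ?_
  obtain ⟨a, ha, hba⟩ := hA.2 b hb
  refine hba.trans_lt ((lt_add_one a).trans_le (le_csSup ⟨l, ?_⟩ (mem_image_of_mem _ ha)))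
  rintro _ ⟨x, hx, rfl⟩
  exact add_one_le_of_lt (hA.1 hx)

theorem inUlt_of_cof_le (hU : IsNormalUltrafilter δ U) {l : Ordinal.{0}} (hl : IsSuccLimit l)
    (hcof : l.cof ≤ δ) {A : Set Ordinal.{0}} (hAl : A ⊆ Iio l)
    (hA : ∀ α < l, InUlt hU (A ∩ Iio α)) : InUlt hU A := by
  obtain ⟨e, hel, -, hecof⟩ := exists_cofinal_map hl
  choose f _ hf using fun ξ => hA (e ξ) (hel ξ)
  refine inUlt_of_forall hU hAl (fun i => ⋃ ξ < i.1, f ξ i) fun g hg => ⟨fun h => ?_, fun h => ?_⟩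
  · have hex : ∀ i : Idx δ, ∃ ξ, g i ∈ ⋃ ξ < i.1, f ξ i → ξ < i.1 ∧ g i ∈ f ξ i := fun i => by
      by_cases hi : g i ∈ ⋃ ξ < i.1, f ξ i
      · obtain ⟨ξ, hξ, hgi⟩ := mem_iUnion₂.1 hi
        exact ⟨ξ, fun _ => ⟨hξ, hgi⟩⟩
      · exact ⟨0, fun hi' => (hi hi').elim⟩
    choose k hk using hex
    obtain ⟨c, hc⟩ := hU.normal k (h.mono fun i hi => (hk i hi).1)
    have hgc : ordRank hU g ∈ ultSet hU (f c) := by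
      rw [ordRank_mem_ultSet_iff]
      filter_upwards [h, hc] with i hi (hi' : k i = c) using hi' ▸ (hk i hi).2
    rw [← hf] at hgc
    exact hgc.1
  · obtain ⟨ξ, hξ, hgξ⟩ := hecof _ hg
    have hmem : ordRank hU g ∈ ultSet hU (f ξ) := hf ξ ▸ ⟨h, hgξ⟩
    rw [ordRank_mem_ultSet_iff] at hmem
    filter_upwards [hmem, eventually_lt_idx hU (hξ.trans_le (ord_le_ord.2 hcof))] with i h₁ h₂
    exact mem_iUnion₂.2 ⟨ξ, h₂, h₁⟩

theorem exists_homogeneous_idx_set {κ : Cardinal.{0}} (hκ : IsWeaklyCompact κ) (hδ : δ < κ)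
    (C : Ordinal.{0} → Ordinal.{0} → Set (Idx δ)) :
    ∃ H : Set Ordinal.{0}, H ⊆ Iio κ.ord ∧ Cardinal.lift.{1} κ ≤ #H ∧
      ∀ a ∈ H, ∀ b ∈ H, ∀ a' ∈ H, ∀ b' ∈ H, a < b → a' < b' → C a b = C a' b' := by
  have : Small.{0} (Idx δ) := Ordinal.small_Iio δ.ord
  have hcard : #(Shrink.{0} (Idx δ)) = δ := by
    rw [← Cardinal.lift_inj.{0, 1}]
    have h₁ := Cardinal.lift_mk_shrink''.{1, 0} (Idx δ)
    have h₂ : #(Idx δ) = _ := Cardinal.mk_Iio_ordinal δ.ord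
    rw [h₁, h₂, card_ord]
  obtain ⟨H, h₁, h₂, h₃⟩ := hκ.2 (Set (Shrink.{0} (Idx δ)))
    (fun a b => equivShrink (Idx δ) '' C a b)
    (by rw [mk_set, hcard]; exact hκ.two_power_lt hδ)
  exact ⟨H, h₁, h₂, fun a ha b hb a' ha' b' hb' hab hab' =>
    (equivShrink (Idx δ)).injective.image_injective (h₃ a ha b hb a' ha' b' hb' hab hab')⟩

theorem inUlt_of_isWeaklyCompact_cof (hU : IsNormalUltrafilter δ U) {l : Ordinal.{0}}
    (hl : IsSuccLimit l) (hκ : IsWeaklyCompact l.cof) (hδ : δ < l.cof) {A : Set Ordinal.{0}}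
    (hAl : A ⊆ Iio l) (hA : ∀ α < l, InUlt hU (A ∩ Iio α)) : InUlt hU A := by
  obtain ⟨e, hel, hemono, hecof⟩ := exists_cofinal_map hl
  choose f _ hf using fun ξ => hA (e ξ) (hel ξ)
  choose r hr using fun ξ => exists_ordRank_eq hU (e ξ)
  have hcoh : ∀ ξ η, ξ < η → η < l.cof.ord → ∀ᶠ i in U, f ξ i = f η i ∩ Iio (r ξ i) := by
    intro ξ η hξη hη
    refine eventuallyEq_of_ultSet_eq hU ?_
    rw [ultSet_inter_Iio, ← hf, ← hf, hr, inter_assoc, Iio_inter_Iio,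
      min_eq_right (hemono ξ η hξη hη).le]
  obtain ⟨H, hHsub, hHcard, hH⟩ := exists_homogeneous_idx_set hκ hδ
    fun ξ η => {i : Idx δ | f ξ i = f η i ∩ Iio (r ξ i)}
  have hHunb : ∀ o < l.cof.ord, ∃ ξ ∈ H, o < ξ := fun o ho =>
    exists_mem_gt_of_card_le hκ.1.le hHcard ho
  have hX : ∀ᶠ i in U, ∀ ξ ∈ H, ∀ η ∈ H, ξ < η → f ξ i = f η i ∩ Iio (r ξ i) := by
    obtain ⟨x, hx, -⟩ := hHunb 0 (isSuccLimit_ord hκ.1.le).bot_lt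
    obtain ⟨y, hy, hxy⟩ := hHunb x (hHsub hx)
    filter_upwards [hcoh x y hxy (hHsub hy)] with i hi ξ hξ η hη hξη
    exact (Set.ext_iff.1 (hH x hx y hy ξ hξ η hη hxy hξη) i).1 hi
  refine inUlt_of_forall hU hAl (fun i => ⋃ ξ ∈ H, f ξ i) fun g hg => ?_
  obtain ⟨ξ, hξH, hgξ⟩ : ∃ ξ ∈ H, ordRank hU g < e ξ := by
    obtain ⟨ξ, hξ, hgξ⟩ := hecof _ hg
    obtain ⟨η, hη, hξη⟩ := hHunb ξ hξ
    exact ⟨η, hη, hgξ.trans (hemono ξ η hξη (hHsub hη))⟩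
  have hgA : ordRank hU g ∈ A ↔ ∀ᶠ i in U, g i ∈ f ξ i := by
    rw [← ordRank_mem_ultSet_iff hU, ← hf]
    exact ⟨fun h => ⟨h, hgξ⟩, And.left⟩
  have hgr : ∀ᶠ i in U, g i < r ξ i := by rwa [← ordRank_lt_iff hU, hr]
  rw [hgA]
  refine eventually_congr ?_
  filter_upwards [hX, hgr] with i hi hgi
  refine ⟨fun h => ?_, fun h => mem_iUnion₂.2 ⟨ξ, hξH, h⟩⟩
  obtain ⟨η, hη, hgη⟩ := mem_iUnion₂.1 h
  rcases lt_trichotomy η ξ with hlt | rfl | hgt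
  · rw [hi η hη ξ hξH hlt] at hgη
    exact hgη.1
  · exact hgη
  · rw [hi ξ hξH η hη hgt]
    exact ⟨hgη, hgi⟩

/-- If the cofinality of the limit ordinal `λ` is at most `δ`, or is a weakly compact
cardinal, then no unbounded subset of `λ` is fresh over `Ult(V,U)`. -/
theorem stmt0 (δ : Cardinal.{0}) (U : Ultrafilter (Idx δ)) (hU : IsNormalUltrafilter δ U)
    (l : Ordinal.{0}) (hl : Order.IsSuccLimit l)
    (h : l.cof ≤ δ ∨ IsWeaklyCompact l.cof) :
    ¬ ∃ A : Set Ordinal.{0}, UnbSub A l ∧ Fresh hU A := by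
  rintro ⟨A, hA, hnot, hinit⟩
  have hinit' : ∀ α < l, InUlt hU (A ∩ Iio α) := fun α hα => hinit α (hα.trans_le (le_lub hA))
  rcases le_or_gt l.cof δ with hle | hlt
  · exact hnot (inUlt_of_cof_le hU hl hle hA.1 hinit')
  · exact hnot (inUlt_of_isWeaklyCompact_cof hU hl (h.resolve_left hlt.not_ge) hlt hA.1 hinit')

end MU
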